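/- Let d ≥ 1, let P be any finite partially ordered set on [d] = {1,...,d}, and let G be any perfect graph on [d]. Then Ω(O_P, Q_G) = conv((O_P × {1}) ∪ ((−Q_G) × {−1})) ⊂ ℝ^{d+1} is a reflexive polytope with the integer decomposition property. -/

import Mathlib

open scoped Pointwise

namespace HibiTsuchiya

/-- A point of `ℝ^n` is a *lattice point* if all of its coordinates are integers. -/
def IsLatticePoint {n : ℕ} (x : Fin n → ℝ) : Prop := ∀ i, ∃ z : ℤ, x i = (z : ℝ)

/-- The dual polytope `P^∨ = {x : ⟨x,y⟩ ≤ 1 for all y ∈ P}`. -/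
def dualPolytope {n : ℕ} (P : Set (Fin n → ℝ)) : Set (Fin n → ℝ) :=
  {x | ∀ y ∈ P, ∑ i, x i * y i ≤ 1}

/-- A polytope `P ⊆ ℝ^n` is *reflexive* if the origin is an interior point of `P` and the
dual polytope of `P` is again a lattice polytope (i.e. the convex hull of finitely many
lattice points). -/
def IsReflexive {n : ℕ} (P : Set (Fin n → ℝ)) : Prop :=
  0 ∈ interior P ∧
    ∃ V : Finset (Fin n → ℝ), (∀ v ∈ V, IsLatticePoint v) ∧
      dualPolytope P = convexHull ℝ (V : Set (Fin n → ℝ))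

/-- `P` has the *integer decomposition property* if every lattice point of `m • P` (`m ≥ 1`)
is a sum of `m` lattice points of `P`. -/
def HasIDP {n : ℕ} (P : Set (Fin n → ℝ)) : Prop :=
  ∀ m : ℕ, 0 < m → ∀ a : Fin n → ℝ, IsLatticePoint a → a ∈ (m : ℝ) • P →
    ∃ f : Fin m → Fin n → ℝ, (∀ k, f k ∈ P ∧ IsLatticePoint (f k)) ∧ a = ∑ k, f k

/-- The indicator vector `ρ(S) = ∑_{j ∈ S} e_j` of a subset `S ⊆ [n]`. -/
noncomputable def indicator {n : ℕ} (S : Set (Fin n)) : Fin n → ℝ :=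
  S.indicator (fun _ => (1 : ℝ))

/-- A poset ideal of a partial order `P` on `[n]`. -/
def IsPosetIdeal {n : ℕ} (P : PartialOrder (Fin n)) (I : Set (Fin n)) : Prop :=
  ∀ i ∈ I, ∀ j, P.le j i → j ∈ I

/-- The order polytope `O_P`: the convex hull of the indicator vectors of poset ideals. -/
noncomputable def orderPolytope {n : ℕ} (P : PartialOrder (Fin n)) : Set (Fin n → ℝ) :=
  convexHull ℝ {x | ∃ I : Set (Fin n), IsPosetIdeal P I ∧ x = indicator I}

/-- An antichain of a partial order `P` on `[n]`: a pairwise incomparable subset. -/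
def IsPosetAntichain {n : ℕ} (P : PartialOrder (Fin n)) (A : Set (Fin n)) : Prop :=
  ∀ i ∈ A, ∀ j ∈ A, i ≠ j → ¬ P.le i j ∧ ¬ P.le j i

/-- The chain polytope `C_P`: the convex hull of the indicator vectors of antichains. -/
noncomputable def chainPolytope {n : ℕ} (P : PartialOrder (Fin n)) : Set (Fin n → ℝ) :=
  convexHull ℝ {x | ∃ A : Set (Fin n), IsPosetAntichain P A ∧ x = indicator A}

/-- A stable (independent) set of a graph. -/
def IsStableSet {V : Type*} (G : SimpleGraph V) (S : Set V) : Prop :=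
  ∀ i ∈ S, ∀ j ∈ S, ¬ G.Adj i j

/-- The stable set polytope `Q_G`: the convex hull of the indicator vectors of stable sets. -/
noncomputable def stableSetPolytope {n : ℕ} (G : SimpleGraph (Fin n)) : Set (Fin n → ℝ) :=
  convexHull ℝ {x | ∃ S : Set (Fin n), IsStableSet G S ∧ x = indicator S}

/-- The clique number of a graph, as an extended natural number. -/
noncomputable def cliqueNumber {V : Type*} (G : SimpleGraph V) : ℕ∞ :=
  ⨆ (t : Finset V) (_ : G.IsClique (t : Set V)), (t.card : ℕ∞)

/-- A graph is *perfect* if for every induced subgraph (including the graph itself)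
the chromatic number equals the clique number. -/
def IsPerfectGraph {V : Type*} (G : SimpleGraph V) : Prop :=
  ∀ s : Set V, (G.induce s).chromaticNumber = cliqueNumber (G.induce s)

/-- A simplicial complex on the vertex set `[n]`. -/
def IsSimplicialComplex {n : ℕ} (Δ : Set (Finset (Fin n))) : Prop :=
  (∀ i : Fin n, {i} ∈ Δ) ∧ ∀ F ∈ Δ, ∀ F' ⊆ F, F' ∈ Δ

/-- The polytope `P_Δ`: the convex hull of the indicator vectors of the faces of `Δ`. -/
noncomputable def complexPolytope {n : ℕ} (Δ : Set (Finset (Fin n))) : Set (Fin n → ℝ) :=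
  convexHull ℝ {x | ∃ F ∈ Δ, x = indicator (↑F : Set (Fin n))}

/-- `Γ(P,Q) = conv(P ∪ (−Q))`. -/
noncomputable def gammaPolytope {n : ℕ} (P Q : Set (Fin n → ℝ)) : Set (Fin n → ℝ) :=
  convexHull ℝ (P ∪ -Q)

/-- `Ω(P,Q) = conv((P × {1}) ∪ ((−Q) × {−1})) ⊆ ℝ^{n+1}`. -/
noncomputable def omegaPolytope {n : ℕ} (P Q : Set (Fin n → ℝ)) : Set (Fin (n+1) → ℝ) :=
  convexHull ℝ
    ((fun x : Fin n → ℝ => Fin.snoc x (1 : ℝ)) '' P ∪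
     (fun x : Fin n → ℝ => Fin.snoc x (-1 : ℝ)) '' (-Q))

/-! ### Auxiliary material -/

open Classical in
lemma perfect_decomp {d : ℕ} (G : SimpleGraph (Fin d)) (hG : IsPerfectGraph G) :
    ∀ (n : ℕ) (w : Fin d → ℕ) (k : ℕ), ∑ i, w i = n →
      (∀ C : Finset (Fin d), G.IsClique (C : Set (Fin d)) → ∑ i ∈ C, w i ≤ k) →
      ∃ S : Fin k → Set (Fin d), (∀ j, IsStableSet G (S j)) ∧
        ∀ v, ∑ j, (if v ∈ S j then 1 else 0) = w v := by
  intro n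
  induction n using Nat.strong_induction_on with
  | _ n ih =>
  intro w k hn hk
  by_cases hw : ∀ v, w v ≤ 1
  · -- base case: colour the induced subgraph
    set s : Set (Fin d) := {v | w v = 1} with hs
    have hcl : cliqueNumber (G.induce s) ≤ k := by
      unfold cliqueNumber
      refine iSup₂_le ?_
      intro t ht
      have h1 : G.IsClique ((t.map (Function.Embedding.subtype _) : Finset (Fin d)) :
          Set (Fin d)) := by
        intro a ha b hb hab
        simp only [Finset.coe_map, Set.mem_image, Finset.mem_coe] at ha hb
        obtain ⟨a', ha', rfl⟩ := ha
        obtain ⟨b', hb', rfl⟩ := hb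
        have hne : a' ≠ b' := fun h => hab (by rw [h])
        exact ht ha' hb' hne
      have h2 := hk _ h1
      rw [Finset.sum_map] at h2
      have h3 : ∑ x ∈ t, w ((Function.Embedding.subtype _) x) = t.card := by
        rw [Finset.card_eq_sum_ones]
        refine Finset.sum_congr rfl ?_
        intro x _
        exact x.2
      rw [h3] at h2
      exact_mod_cast h2
    rw [← hG s] at hcl
    obtain ⟨c⟩ := SimpleGraph.chromaticNumber_le_iff_colorable.1 hcl
    refine ⟨fun j => {v | ∃ h : v ∈ s, c ⟨v, h⟩ = j}, ?_, ?_⟩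
    · rintro j a ⟨ha, hca⟩ b ⟨hb, hcb⟩ hab
      have : (G.induce s).Adj ⟨a, ha⟩ ⟨b, hb⟩ := hab
      exact c.valid this (hca.trans hcb.symm)
    · intro v
      by_cases hv : v ∈ s
      · have : ∀ j, (v ∈ {v | ∃ h : v ∈ s, c ⟨v, h⟩ = j}) ↔ c ⟨v, hv⟩ = j := by
          intro j
          constructor
          · rintro ⟨_, h⟩
            exact h
          · intro h
            exact ⟨hv, h⟩
        simp only [this]
        rw [Finset.sum_ite_eq]
        simp only [Finset.mem_univ, if_true]
        exact hv.symm
      · have : ∀ j, ¬ (v ∈ {v | ∃ h : v ∈ s, c ⟨v, h⟩ = j}) := by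
          rintro j ⟨h, _⟩
          exact hv h
        simp only [this, if_false, Finset.sum_const_zero]
        have h1 := hw v
        have h2 : w v ≠ 1 := hv
        omega
  · push Not at hw
    obtain ⟨v, hv⟩ := hw
    set w' : Fin d → ℕ := fun u => if u = v then w u - 1 else w u with hw'
    have hww : ∀ u, w u = w' u + if u = v then 1 else 0 := by
      intro u
      simp only [hw']
      split_ifs with h
      · subst h; omega
      · omega
    have hsum : ∀ C : Finset (Fin d), ∑ i ∈ C, w i = ∑ i ∈ C, w' i + if v ∈ C then 1 else 0 := by
      intro C
      rw [Finset.sum_congr rfl (fun u _ => hww u), Finset.sum_add_distrib, Finset.sum_ite_eq']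
    have hlt : ∑ i, w' i < n := by
      have := hsum Finset.univ
      simp at this
      omega
    obtain ⟨S, hS, hSw⟩ := ih _ hlt w' k rfl (fun C hC => by
      have := hsum C
      have := hk C hC
      omega)
    have hex : ∃ i, v ∈ S i := by
      by_contra hno
      push Not at hno
      have := hSw v
      simp [hno, hw'] at this
      omega
    obtain ⟨i, hi⟩ := hex
    obtain ⟨k', rfl⟩ : ∃ k', k = k' + 1 := by
      cases k with
      | zero => exact i.elim0
      | succ k' => exact ⟨k', rfl⟩
    set w'' : Fin d → ℕ := fun u => ∑ j, (if u ∈ S (i.succAbove j) then 1 else 0) +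
      if u = v then 1 else 0 with hw''
    have hw2 : ∀ u, w u = w'' u + if u ∈ S i then 1 else 0 := by
      intro u
      rw [hww u, ← hSw u, Fin.sum_univ_succAbove _ i]
      simp only [hw'']
      omega
    have hlt2 : ∑ u, w'' u < n := by
      rw [← hn]
      refine Finset.sum_lt_sum (fun u _ => by rw [hw2 u]; omega) ⟨v, Finset.mem_univ _, ?_⟩
      rw [hw2 v]
      simp [hi]
    obtain ⟨T, hT, hTw⟩ := ih _ hlt2 w'' k' rfl (by
      intro C hC
      by_cases hvC : v ∈ C
      · have h1 := hk C hC
        rw [Finset.sum_congr rfl (fun u _ => hw2 u), Finset.sum_add_distrib] at h1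
        have h2 : (if v ∈ S i then 1 else 0) ≤ ∑ u ∈ C, (if u ∈ S i then 1 else 0) :=
          Finset.single_le_sum (f := fun u => if u ∈ S i then 1 else 0)
            (fun _ _ => Nat.zero_le _) hvC
        rw [if_pos hi] at h2
        omega
      · have h1 : ∑ u ∈ C, w'' u =
            ∑ u ∈ C, ∑ j, (if u ∈ S (i.succAbove j) then 1 else 0) := by
          refine Finset.sum_congr rfl ?_
          intro u hu
          have : u ≠ v := fun h => hvC (h ▸ hu)
          simp [hw'', this]
        rw [h1, Finset.sum_comm]
        calc ∑ j : Fin k', ∑ u ∈ C, (if u ∈ S (i.succAbove j) then 1 else 0)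
            ≤ ∑ _j : Fin k', 1 := by
              refine Finset.sum_le_sum ?_
              intro j _
              rw [← Finset.card_filter, Finset.card_le_one]
              intro a ha b hb
              simp only [Finset.mem_filter] at ha hb
              by_contra hab
              exact hS _ a ha.2 b hb.2 (hC ha.1 hb.1 hab)
          _ = k' := by simp)
    refine ⟨Fin.cons (S i) T, ?_, ?_⟩
    · intro j
      refine Fin.cases ?_ ?_ j
      · simpa using hS i
      · intro j
        simpa using hT j
    · intro u
      rw [Fin.sum_univ_succ]
      simp only [Fin.cons_zero, Fin.cons_succ]
      rw [hTw u, hw2 u]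
      omega

lemma clique_inter_stable {d : ℕ} (G : SimpleGraph (Fin d)) (C : Finset (Fin d))
    (hC : G.IsClique (C : Set (Fin d))) (S : Set (Fin d)) (hS : IsStableSet G S) :
    ∑ i ∈ C, indicator S i ≤ 1 := by
  classical
  have h : ∑ i ∈ C, indicator S i = ((C.filter (fun i => i ∈ S)).card : ℝ) := by
    rw [Finset.card_filter]
    push_cast
    refine Finset.sum_congr rfl ?_
    intro i _
    simp [indicator, Set.indicator_apply]
  rw [h]
  have : (C.filter (fun i => i ∈ S)).card ≤ 1 := by
    rw [Finset.card_le_one]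
    intro a ha b hb
    simp only [Finset.mem_filter] at ha hb
    by_contra hab
    exact hS a ha.2 b hb.2 (hC ha.1 hb.1 hab)
  exact_mod_cast this

/-- Integer points: decomposition into stable sets. -/
lemma stable_int {d : ℕ} (G : SimpleGraph (Fin d)) (hG : IsPerfectGraph G)
    (w : Fin d → ℕ) (k : ℕ)
    (hk : ∀ C : Finset (Fin d), G.IsClique (C : Set (Fin d)) → ∑ i ∈ C, w i ≤ k) :
    ∃ S : Fin k → Set (Fin d), (∀ j, IsStableSet G (S j)) ∧
      ∀ v, ∑ j, indicator (S j) v = (w v : ℝ) := by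
  classical
  obtain ⟨S, hS, h⟩ := perfect_decomp G hG _ w k rfl hk
  refine ⟨S, hS, fun v => ?_⟩
  rw [← h v]
  push_cast
  refine Finset.sum_congr rfl ?_
  intro j _
  simp [indicator, Set.indicator_apply]

/-- Integer points: decomposition into poset ideals. -/
lemma ideal_int {d : ℕ} (P : PartialOrder (Fin d)) (w : Fin d → ℕ) (k : ℕ)
    (hmono : ∀ i j, P.le i j → w j ≤ w i) (hk : ∀ i, w i ≤ k) :
    ∃ S : Fin k → Set (Fin d), (∀ j, IsPosetIdeal P (S j)) ∧
      ∀ v, ∑ j, indicator (S j) v = (w v : ℝ) := by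
  classical
  refine ⟨fun j => {i | (j : ℕ) < w i}, ?_, ?_⟩
  · intro j a ha b hb
    exact lt_of_lt_of_le (show (j : ℕ) < w a from ha) (hmono _ _ hb)
  · intro v
    have h1 : ∀ j : Fin k, indicator {i | (j : ℕ) < w i} v = if (j : ℕ) < w v then (1 : ℝ) else 0 := by
      intro j
      simp [indicator, Set.indicator_apply]
    simp only [h1]
    rw [Fin.sum_univ_eq_sum_range (fun j => if j < w v then (1 : ℝ) else 0), ← Finset.sum_filter]
    have h2 : (Finset.range k).filter (fun j => j < w v) = Finset.range (w v) := by
      ext j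
      have := hk v
      simp only [Finset.mem_filter, Finset.mem_range]
      omega
    rw [h2]
    simp

lemma approx {d : ℕ} (K : Set (Fin d → ℝ)) (hc : IsClosed K) (hK : Convex ℝ K)
    (x : Fin d → ℝ) (hx : ∀ i, 0 ≤ x i)
    (h : ∀ N : ℕ, ∃ g : Fin (N + 1) → (Fin d → ℝ), (∀ j, g j ∈ K) ∧
      ∀ i, ∑ j, g j i = (⌊x i * ((N + 1 : ℕ) : ℝ)⌋₊ : ℝ)) : x ∈ K := by
  have hlim : Filter.Tendsto
      (fun N : ℕ => fun i => (⌊x i * ((N + 1 : ℕ) : ℝ)⌋₊ : ℝ) / ((N + 1 : ℕ) : ℝ))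
      Filter.atTop (nhds x) := by
    rw [tendsto_pi_nhds]
    intro i
    have h1 := tendsto_nat_floor_mul_div_atTop (R := ℝ) (hx i)
    have h2 : Filter.Tendsto (fun N : ℕ => ((N + 1 : ℕ) : ℝ)) Filter.atTop Filter.atTop :=
      tendsto_natCast_atTop_atTop.comp (Filter.tendsto_add_atTop_nat 1)
    exact h1.comp h2
  refine hc.mem_of_tendsto hlim (Filter.Eventually.of_forall ?_)
  intro N
  obtain ⟨g, hg, hs⟩ := h N
  have hpos : (0 : ℝ) < ((N + 1 : ℕ) : ℝ) := by positivity
  have h3 : (fun i => (⌊x i * ((N + 1 : ℕ) : ℝ)⌋₊ : ℝ) / ((N + 1 : ℕ) : ℝ)) =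
      ∑ j : Fin (N + 1), (1 / ((N + 1 : ℕ) : ℝ)) • g j := by
    ext i
    rw [← hs i, Finset.sum_apply, Finset.sum_div]
    refine Finset.sum_congr rfl ?_
    intro j _
    simp only [Pi.smul_apply, smul_eq_mul]
    ring
  rw [h3]
  refine hK.sum_mem (fun _ _ => by positivity) ?_ (fun j _ => hg j)
  rw [Finset.sum_const, Finset.card_univ, Fintype.card_fin, nsmul_eq_mul]
  field_simp

lemma finite_ind {d : ℕ} (p : Set (Fin d) → Prop) :
    {x : Fin d → ℝ | ∃ I : Set (Fin d), p I ∧ x = indicator I}.Finite := by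
  refine (Set.finite_range (indicator (n := d))).subset ?_
  rintro x ⟨I, _, rfl⟩
  exact ⟨I, rfl⟩

lemma order_real {d : ℕ} (P : PartialOrder (Fin d)) (x : Fin d → ℝ) (a : ℝ) (ha : 0 ≤ a)
    (hx : ∀ i, 0 ≤ x i) (hmono : ∀ i j, P.le i j → x j ≤ x i) (hxa : ∀ i, x i ≤ a) :
    ∃ p ∈ orderPolytope P, x = a • p := by
  rcases ha.eq_or_lt with rfl | ha
  · refine ⟨indicator ∅, subset_convexHull ℝ _ ⟨∅, fun i hi => hi.elim, rfl⟩, ?_⟩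
    ext i
    simp [le_antisymm (hxa i) (hx i)]
  refine ⟨a⁻¹ • x, ?_, by rw [smul_smul, mul_inv_cancel₀ ha.ne', one_smul]⟩
  refine approx _ ((finite_ind _).isClosed_convexHull ℝ) (convex_convexHull ℝ _) _
    (fun i => mul_nonneg (by positivity) (hx i)) ?_
  intro N
  have hpos : (0 : ℝ) < ((N + 1 : ℕ) : ℝ) := by positivity
  obtain ⟨S, hS, hsum⟩ := ideal_int P (fun i => ⌊(a⁻¹ • x) i * ((N + 1 : ℕ) : ℝ)⌋₊) (N + 1)
    (fun i j hij => Nat.floor_le_floor (by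
      have := hmono i j hij
      simp only [Pi.smul_apply, smul_eq_mul]
      gcongr))
    (fun i => by
      refine Nat.floor_le_of_le ?_
      have h1 : (a⁻¹ • x) i ≤ 1 := by
        simp only [Pi.smul_apply, smul_eq_mul]
        rw [inv_mul_le_iff₀ ha]
        simpa using hxa i
      nlinarith)
  exact ⟨fun j => indicator (S j), fun j => subset_convexHull ℝ _ ⟨S j, hS j, rfl⟩, hsum⟩

lemma stable_real {d : ℕ} (G : SimpleGraph (Fin d)) (hG : IsPerfectGraph G)
    (x : Fin d → ℝ) (a : ℝ) (ha : 0 ≤ a) (hx : ∀ i, 0 ≤ x i)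
    (hC : ∀ C : Finset (Fin d), G.IsClique (C : Set (Fin d)) → ∑ i ∈ C, x i ≤ a) :
    ∃ p ∈ stableSetPolytope G, x = a • p := by
  rcases ha.eq_or_lt with rfl | ha
  · refine ⟨indicator ∅, subset_convexHull ℝ _ ⟨∅, fun i hi => hi.elim, rfl⟩, ?_⟩
    ext i
    have := hC {i} (by simp)
    simp only [Finset.sum_singleton] at this
    simp [le_antisymm this (hx i)]
  refine ⟨a⁻¹ • x, ?_, by rw [smul_smul, mul_inv_cancel₀ ha.ne', one_smul]⟩
  refine approx _ ((finite_ind _).isClosed_convexHull ℝ) (convex_convexHull ℝ _) _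
    (fun i => mul_nonneg (by positivity) (hx i)) ?_
  intro N
  have hpos : (0 : ℝ) < ((N + 1 : ℕ) : ℝ) := by positivity
  obtain ⟨S, hS, hsum⟩ := stable_int G hG (fun i => ⌊(a⁻¹ • x) i * ((N + 1 : ℕ) : ℝ)⌋₊) (N + 1)
    (fun C hCC => by
      have h1 : ((∑ i ∈ C, ⌊(a⁻¹ • x) i * ((N + 1 : ℕ) : ℝ)⌋₊ : ℕ) : ℝ) ≤
          ((N + 1 : ℕ) : ℝ) := by
        rw [Nat.cast_sum]
        calc ∑ i ∈ C, (⌊(a⁻¹ • x) i * ((N + 1 : ℕ) : ℝ)⌋₊ : ℝ)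
            ≤ ∑ i ∈ C, (a⁻¹ * ((N + 1 : ℕ) : ℝ)) * x i := by
              refine Finset.sum_le_sum ?_
              intro i _
              have h0 : 0 ≤ (a⁻¹ • x) i * ((N + 1 : ℕ) : ℝ) := by
                have := hx i
                simp only [Pi.smul_apply, smul_eq_mul]
                positivity
              refine (Nat.floor_le h0).trans (le_of_eq ?_)
              simp only [Pi.smul_apply, smul_eq_mul]
              ring
          _ = (a⁻¹ * ((N + 1 : ℕ) : ℝ)) * ∑ i ∈ C, x i := by rw [Finset.mul_sum]
          _ ≤ (a⁻¹ * ((N + 1 : ℕ) : ℝ)) * a := by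
              have := hC C hCC
              gcongr
          _ = ((N + 1 : ℕ) : ℝ) := by field_simp
      exact_mod_cast h1)
  exact ⟨fun j => indicator (S j), fun j => subset_convexHull ℝ _ ⟨S j, hS j, rfl⟩, hsum⟩

/-- evaluation of a vector at an optional index (`none` gives `0`). -/
def oev {d : ℕ} (y : Fin d → ℝ) (o : Option (Fin d)) : ℝ := o.elim 0 y

/-- the admissible choices. -/
def Adm {d : ℕ} (P : PartialOrder (Fin d)) (φ : Fin d → Option (Fin d)) : Prop :=
  ∀ i j, φ i = some j → P.le i j

/-- coefficient vector of `oev · o`. -/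
noncomputable def ovec {d : ℕ} (o : Option (Fin d)) : Fin d → ℝ :=
  o.elim 0 (fun j => Pi.single j 1)

lemma ovec_dot {d : ℕ} (o : Option (Fin d)) (y : Fin d → ℝ) :
    ∑ i, ovec o i * y i = oev y o := by
  cases o with
  | none => simp [ovec, oev]
  | some j => simp [ovec, oev, Pi.single_apply]

/-- facet normals of the first kind. -/
noncomputable def nA {d : ℕ} (o : Option (Fin d)) : Fin (d + 1) → ℝ :=
  Fin.snoc (fun i => 2 * ovec o i) (-1 : ℝ)

/-- facet normals of the second kind. -/
noncomputable def nB {d : ℕ} (C : Finset (Fin d)) (φ : Fin d → Option (Fin d)) :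
    Fin (d + 1) → ℝ :=
  Fin.snoc (fun i => 2 * ∑ c ∈ C, (ovec (φ c) i - ovec (some c) i)) (1 : ℝ)

/-- the set of normals. -/
def normals {d : ℕ} (P : PartialOrder (Fin d)) (G : SimpleGraph (Fin d)) :
    Set (Fin (d + 1) → ℝ) :=
  Set.range (nA (d := d)) ∪
    {v | ∃ (C : Finset (Fin d)) (φ : Fin d → Option (Fin d)),
      G.IsClique (C : Set (Fin d)) ∧ Adm P φ ∧ v = nB C φ}

lemma normals_finite {d : ℕ} (P : PartialOrder (Fin d)) (G : SimpleGraph (Fin d)) :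
    (normals P G).Finite := by
  refine (Set.finite_range _).union ?_
  refine (Set.finite_range (fun x : Finset (Fin d) × (Fin d → Option (Fin d)) =>
    nB x.1 x.2)).subset ?_
  rintro v ⟨C, φ, _, _, rfl⟩
  exact ⟨(C, φ), rfl⟩

lemma nA_dot {d : ℕ} (o : Option (Fin d)) (y : Fin d → ℝ) (t : ℝ) :
    ∑ i, nA o i * (Fin.snoc y t : Fin (d + 1) → ℝ) i = 2 * oev y o - t := by
  rw [Fin.sum_univ_castSucc]
  simp only [nA, Fin.snoc_castSucc, Fin.snoc_last]
  rw [← ovec_dot, Finset.mul_sum]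
  simp only [mul_assoc]
  ring

lemma nB_dot {d : ℕ} (C : Finset (Fin d)) (φ : Fin d → Option (Fin d)) (y : Fin d → ℝ) (t : ℝ) :
    ∑ i, nB C φ i * (Fin.snoc y t : Fin (d + 1) → ℝ) i =
      2 * ∑ c ∈ C, (oev y (φ c) - y c) + t := by
  rw [Fin.sum_univ_castSucc]
  simp only [nB, Fin.snoc_castSucc, Fin.snoc_last]
  have h : ∀ c, oev y (φ c) - y c = ∑ i, (ovec (φ c) i - ovec (some c) i) * y i := by
    intro c
    have h2 : y c = oev y (some c) := rfl
    rw [h2, ← ovec_dot, ← ovec_dot, ← Finset.sum_sub_distrib]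
    simp only [sub_mul]
  simp only [h]
  rw [Finset.sum_comm, Finset.mul_sum, one_mul]
  congr 1
  refine Finset.sum_congr rfl ?_
  intro i _
  rw [← Finset.sum_mul]
  ring

lemma ovec_int {d : ℕ} (o : Option (Fin d)) (i : Fin d) : ∃ z : ℤ, ovec o i = z := by
  cases o with
  | none => exact ⟨0, by simp [ovec]⟩
  | some j =>
    by_cases h : i = j
    · exact ⟨1, by simp [ovec, h]⟩
    · exact ⟨0, by simp [ovec, h]⟩

lemma normals_lattice {d : ℕ} (P : PartialOrder (Fin d)) (G : SimpleGraph (Fin d))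
    (v : Fin (d + 1) → ℝ) (hv : v ∈ normals P G) : IsLatticePoint v := by
  choose z hz using fun (o : Option (Fin d)) (i : Fin d) => ovec_int o i
  rcases hv with ⟨o, rfl⟩ | ⟨C, φ, _, _, rfl⟩
  · intro i
    refine Fin.lastCases ?_ ?_ i
    · exact ⟨-1, by simp [nA]⟩
    · intro i
      exact ⟨2 * z o i, by simp [nA, hz]⟩
  · intro i
    refine Fin.lastCases ?_ ?_ i
    · exact ⟨1, by simp [nB]⟩
    · intro i
      exact ⟨2 * ∑ c ∈ C, (z (φ c) i - z (some c) i), by simp [nB, hz]⟩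

lemma ind_nonneg {d : ℕ} (S : Set (Fin d)) (i : Fin d) : 0 ≤ indicator S i :=
  Set.indicator_nonneg (fun _ _ => zero_le_one) i

lemma ind_le_one {d : ℕ} (S : Set (Fin d)) (i : Fin d) : indicator S i ≤ 1 := by
  classical
  simp only [indicator, Set.indicator_apply]
  split_ifs <;> norm_num

lemma convex_half {n : ℕ} (v : Fin n → ℝ) (c : ℝ) :
    Convex ℝ {z : Fin n → ℝ | ∑ i, v i * z i ≤ c} := by
  refine convex_halfSpace_le ⟨?_, ?_⟩ c
  · intro x y
    simp [mul_add, Finset.sum_add_distrib]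
  · intro a x
    simp only [Pi.smul_apply, smul_eq_mul, Finset.mul_sum]
    refine Finset.sum_congr rfl ?_
    intro i _
    ring

lemma normals_valid {d : ℕ} (P : PartialOrder (Fin d)) (G : SimpleGraph (Fin d))
    (v : Fin (d + 1) → ℝ) (hv : v ∈ normals P G) (z : Fin (d + 1) → ℝ)
    (hz : z ∈ omegaPolytope (orderPolytope P) (stableSetPolytope G)) :
    ∑ i, v i * z i ≤ 1 := by
  -- reduce to vertices
  have key : (∀ I, IsPosetIdeal P I →
        ∑ i, v i * (Fin.snoc (indicator I) (1 : ℝ) : Fin (d + 1) → ℝ) i ≤ 1) →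
      (∀ S, IsStableSet G S →
        ∑ i, v i * (Fin.snoc (-indicator S) (-1 : ℝ) : Fin (d + 1) → ℝ) i ≤ 1) →
      ∑ i, v i * z i ≤ 1 := by
    intro h1 h2
    refine convexHull_min ?_ (convex_half v 1) hz
    rintro _ (⟨p, hp, rfl⟩ | ⟨q, hq, rfl⟩)
    · simp only [Set.mem_ofPred_eq, Fin.sum_univ_castSucc, Fin.snoc_castSucc, Fin.snoc_last]
        at h1 ⊢
      have : ∑ i : Fin d, v i.castSucc * p i ≤ 1 - v (Fin.last d) * 1 := by
        refine convexHull_min ?_ (convex_half (fun i => v i.castSucc) _) hp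
        rintro _ ⟨I, hI, rfl⟩
        have := h1 I hI
        simp only [Set.mem_ofPred_eq]
        linarith
      linarith
    · simp only [Set.mem_ofPred_eq, Fin.sum_univ_castSucc, Fin.snoc_castSucc, Fin.snoc_last]
        at h2 ⊢
      have : ∑ i : Fin d, (-v i.castSucc) * (-q) i ≤ 1 - v (Fin.last d) * (-1) := by
        refine convexHull_min ?_ (convex_half (fun i => -v i.castSucc) _) hq
        rintro _ ⟨S, hS, rfl⟩
        have := h2 S hS
        simp only [Set.mem_ofPred_eq]
        simp only [Pi.neg_apply, mul_neg, neg_mul] at this ⊢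
        linarith
      simp only [Pi.neg_apply, mul_neg, neg_mul, neg_neg] at this ⊢
      linarith
  refine key ?_ ?_
  · intro I hI
    rcases hv with ⟨o, rfl⟩ | ⟨C, φ, hC, hφ, rfl⟩
    · rw [nA_dot]
      cases o with
      | none => simp [oev]
      | some j =>
        have := ind_le_one I j
        simp only [oev, Option.elim]
        linarith
    · rw [nB_dot]
      have : ∑ c ∈ C, (oev (indicator I) (φ c) - indicator I c) ≤ 0 := by
        refine Finset.sum_nonpos ?_
        intro c _
        rcases h : φ c with _ | j
        · have := ind_nonneg I c
          simp only [oev, Option.elim]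
          linarith
        · have hle := hφ c j h
          simp only [oev, Option.elim]
          by_cases hj : j ∈ I
          · have hc : c ∈ I := hI j hj c hle
            simp [indicator, hj, hc]
          · have := ind_nonneg I c
            have h0 : indicator I j = 0 := by simp [indicator, hj]
            linarith
      linarith
  · intro S hS
    rcases hv with ⟨o, rfl⟩ | ⟨C, φ, hC, hφ, rfl⟩
    · rw [nA_dot]
      cases o with
      | none => simp [oev]
      | some j =>
        have := ind_nonneg S j
        simp only [oev, Option.elim, Pi.neg_apply]
        linarith
    · rw [nB_dot]
      have h1 := clique_inter_stable G C hC S hS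
      have : ∑ c ∈ C, (oev (-indicator S) (φ c) - (-indicator S) c) ≤
          ∑ c ∈ C, indicator S c := by
        refine Finset.sum_le_sum ?_
        intro c _
        rcases h : φ c with _ | j
        · simp [oev]
        · have := ind_nonneg S j
          simp only [oev, Option.elim, Pi.neg_apply]
          linarith
      linarith

/-- The key lemma: the smallest decreasing vector above `y` and `0`. -/
lemma key_lemma {d : ℕ} (P : PartialOrder (Fin d)) (G : SimpleGraph (Fin d))
    (y : Fin d → ℝ) (t m : ℝ)
    (h : ∀ v ∈ normals P G, ∑ i, v i * (Fin.snoc y t : Fin (d + 1) → ℝ) i ≤ m) :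
    0 ≤ m + t ∧ 0 ≤ m - t ∧
    ∃ φ : Fin d → Option (Fin d),
      (∀ i, 0 ≤ oev y (φ i)) ∧ (∀ i j, P.le i j → oev y (φ j) ≤ oev y (φ i)) ∧
      (∀ i, 2 * oev y (φ i) ≤ m + t) ∧ (∀ i, 0 ≤ oev y (φ i) - y i) ∧
      (∀ C : Finset (Fin d), G.IsClique (C : Set (Fin d)) →
        2 * ∑ i ∈ C, (oev y (φ i) - y i) ≤ m - t) := by
  have hA : ∀ o, 2 * oev y o - t ≤ m := by
    intro o
    have := h (nA o) (Or.inl ⟨o, rfl⟩)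
    rwa [nA_dot] at this
  have hB : ∀ (C : Finset (Fin d)) (φ : Fin d → Option (Fin d)), G.IsClique (C : Set (Fin d)) → Adm P φ →
      2 * ∑ c ∈ C, (oev y (φ c) - y c) + t ≤ m := by
    intro C φ hC hφ
    have := h (nB C φ) (Or.inr ⟨C, φ, hC, hφ, rfl⟩)
    rwa [nB_dot] at this
  have hmax : ∀ i : Fin d, ∃ o : Option (Fin d), (∀ j, o = some j → P.le i j) ∧
      ∀ o' : Option (Fin d), (∀ j, o' = some j → P.le i j) → oev y o' ≤ oev y o := by
    intro i
    have hfin : {o : Option (Fin d) | ∀ j, o = some j → P.le i j}.Finite := Set.toFinite _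
    have hne : {o : Option (Fin d) | ∀ j, o = some j → P.le i j}.Nonempty :=
      ⟨none, by intro j hj; cases hj⟩
    obtain ⟨o, ho, hmx⟩ := Set.exists_max_image _ (oev y) hfin hne
    exact ⟨o, ho, fun o' ho' => hmx o' ho'⟩
  choose φ hφ hφmax using hmax
  refine ⟨?_, ?_, φ, ?_, ?_, ?_, ?_, ?_⟩
  · have := hA none
    simp only [oev, Option.elim] at this
    linarith
  · have := hB ∅ φ (by simp) hφ
    simp at this
    linarith
  · intro i
    exact hφmax i none (by intro j hj; cases hj)
  · intro i j hij
    exact hφmax i (φ j) (fun l hl => P.le_trans _ _ _ hij (hφ j l hl))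
  · intro i
    have := hA (φ i)
    linarith
  · intro i
    have := hφmax i (some i) (by
      intro j hj
      cases hj
      exact P.le_refl i)
    simp only [oev, Option.elim] at this ⊢
    linarith
  · intro C hC
    have := hB C φ hC hφ
    linarith

lemma snoc_surj {d : ℕ} (z : Fin (d + 1) → ℝ) :
    z = Fin.snoc (fun i : Fin d => z i.castSucc) (z (Fin.last d)) := by
  ext i
  refine Fin.lastCases ?_ ?_ i
  · simp
  · intro i
    simp

/-- The half-space description of `Ω`. -/
lemma omega_of_normals {d : ℕ} (P : PartialOrder (Fin d)) (G : SimpleGraph (Fin d))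
    (hG : IsPerfectGraph G) (z : Fin (d + 1) → ℝ)
    (h : ∀ v ∈ normals P G, ∑ i, v i * z i ≤ 1) :
    z ∈ omegaPolytope (orderPolytope P) (stableSetPolytope G) := by
  obtain ⟨y, t, rfl⟩ : ∃ (y : Fin d → ℝ) (t : ℝ), z = Fin.snoc y t := ⟨_, _, snoc_surj z⟩
  obtain ⟨h1, h2, φ, hp0, hpm, hpa, hq0, hqC⟩ := key_lemma P G y t 1 h
  obtain ⟨p, hp, hpe⟩ := order_real P (fun i => oev y (φ i)) ((1 + t) / 2) (by linarith) hp0 hpm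
    (fun i => by have := hpa i; linarith)
  obtain ⟨q, hq, hqe⟩ := stable_real G hG (fun i => oev y (φ i) - y i) ((1 - t) / 2) (by linarith)
    hq0 (fun C hC => by have := hqC C hC; linarith)
  have hz : (Fin.snoc y t : Fin (d + 1) → ℝ) =
      ((1 + t) / 2) • (Fin.snoc p (1 : ℝ) : Fin (d + 1) → ℝ) +
      ((1 - t) / 2) • (Fin.snoc (-q) (-1 : ℝ) : Fin (d + 1) → ℝ) := by
    ext i
    refine Fin.lastCases ?_ ?_ i
    · simp only [Fin.snoc_last, Pi.add_apply, Pi.smul_apply, smul_eq_mul]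
      ring
    · intro i
      have e1 := congrFun hpe i
      have e2 := congrFun hqe i
      simp only [Fin.snoc_castSucc, Pi.add_apply, Pi.smul_apply, smul_eq_mul, Pi.neg_apply]
        at e1 e2 ⊢
      linarith
  rw [hz]
  have hconv : Convex ℝ (omegaPolytope (orderPolytope P) (stableSetPolytope G)) :=
    convex_convexHull ℝ _
  refine hconv (subset_convexHull ℝ _ (Or.inl ⟨p, hp, rfl⟩))
    (subset_convexHull ℝ _ (Or.inr ⟨-q, by simpa using hq, rfl⟩)) (by linarith) (by linarith)
    (by ring)

/-- `a` is a sum of `m` lattice points of `Q`. -/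
def Dec {n : ℕ} (Q : Set (Fin n → ℝ)) (m : ℕ) (a : Fin n → ℝ) : Prop :=
  ∃ f : Fin m → Fin n → ℝ, (∀ k, f k ∈ Q ∧ IsLatticePoint (f k)) ∧ a = ∑ k, f k

lemma Dec.add {n : ℕ} {Q : Set (Fin n → ℝ)} {m k : ℕ} {a b : Fin n → ℝ}
    (ha : Dec Q m a) (hb : Dec Q k b) : Dec Q (m + k) (a + b) := by
  obtain ⟨f, hf, rfl⟩ := ha
  obtain ⟨g, hg, rfl⟩ := hb
  refine ⟨Fin.append f g, ?_, ?_⟩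
  · intro i
    refine Fin.addCases ?_ ?_ i
    · intro i
      simpa using hf i
    · intro i
      simpa using hg i
  · rw [Fin.sum_univ_add]
    simp

lemma ind_lattice {d : ℕ} (S : Set (Fin d)) (i : Fin d) : ∃ z : ℤ, indicator S i = z := by
  by_cases h : i ∈ S
  · exact ⟨1, by simp [indicator, h]⟩
  · exact ⟨0, by simp [indicator, h]⟩

lemma zero_mem_omega {d : ℕ} (P : PartialOrder (Fin d)) (G : SimpleGraph (Fin d))
    (hG : IsPerfectGraph G) :
    (0 : Fin (d + 1) → ℝ) ∈ omegaPolytope (orderPolytope P) (stableSetPolytope G) :=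
  omega_of_normals P G hG 0 (fun v _ => by simp)

lemma omega_idp {d : ℕ} (P : PartialOrder (Fin d)) (G : SimpleGraph (Fin d))
    (hG : IsPerfectGraph G) :
    HasIDP (omegaPolytope (orderPolytope P) (stableSetPolytope G)) := by
  intro m hm a hlat ha
  change Dec _ m a
  obtain ⟨z, hz, rfl⟩ := ha
  have hnorm : ∀ v ∈ normals P G, ∑ i, v i * ((m : ℝ) • z) i ≤ m := by
    intro v hv
    have h1 := normals_valid P G v hv z hz
    have h2 : ∑ i, v i * ((m : ℝ) • z) i = m * ∑ i, v i * z i := by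
      rw [Finset.mul_sum]
      refine Finset.sum_congr rfl ?_
      intro i _
      simp only [Pi.smul_apply, smul_eq_mul]
      ring
    rw [h2]
    have : (0 : ℝ) ≤ m := by positivity
    nlinarith
  change Dec _ m ((m : ℝ) • z)
  change IsLatticePoint ((m : ℝ) • z) at hlat
  generalize (m : ℝ) • z = a at hnorm hlat
  clear hz
  choose b hb using hlat
  set t : ℤ := b (Fin.last d) with ht
  set y : Fin d → ℝ := fun i => (b i.castSucc : ℝ) with hy
  have ha : a = Fin.snoc y (t : ℝ) := by
    rw [snoc_surj a]
    congr 1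
    · ext i
      exact hb _
    · exact hb _
  rw [ha] at hnorm
  obtain ⟨h1, h2, φ, hp0, hpm, hpa, hq0, hqC⟩ := key_lemma P G y t m hnorm
  -- integrality of `p`
  have hpint : ∀ i, ∃ w : ℕ, oev y (φ i) = w := by
    intro i
    have hi : ∃ u : ℤ, oev y (φ i) = u := by
      rcases φ i with _ | j
      · exact ⟨0, by simp [oev]⟩
      · exact ⟨_, rfl⟩
    obtain ⟨u, hu⟩ := hi
    have h0 := hp0 i
    rw [hu] at h0
    have h0' : 0 ≤ u := by exact_mod_cast h0
    refine ⟨u.toNat, ?_⟩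
    rw [hu]
    have : ((u.toNat : ℤ) : ℝ) = (u : ℝ) := by rw [Int.toNat_of_nonneg h0']
    exact_mod_cast this.symm
  choose p hp using hpint
  have hqint : ∀ i, ∃ w : ℕ, oev y (φ i) - y i = w := by
    intro i
    have h0 := hq0 i
    have e : oev y (φ i) - y i = (((p i : ℤ) - b i.castSucc : ℤ) : ℝ) := by
      rw [hp i]
      push_cast
      rfl
    rw [e] at h0 ⊢
    have h0' : 0 ≤ (p i : ℤ) - b i.castSucc := by exact_mod_cast h0
    refine ⟨((p i : ℤ) - b i.castSucc).toNat, ?_⟩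
    have : ((((p i : ℤ) - b i.castSucc).toNat : ℤ) : ℝ) = (((p i : ℤ) - b i.castSucc : ℤ) : ℝ) := by
      rw [Int.toNat_of_nonneg h0']
    exact_mod_cast this.symm
  choose q hq using hqint
  have h1' : 0 ≤ (m : ℤ) + t := by exact_mod_cast h1
  have h2' : 0 ≤ (m : ℤ) - t := by exact_mod_cast h2
  obtain ⟨S, hS, hSs⟩ := ideal_int P p (((m : ℤ) + t) / 2).toNat
    (fun i j hij => by
      have := hpm i j hij
      rw [hp, hp] at this
      exact_mod_cast this)
    (fun i => by
      have := hpa i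
      rw [hp] at this
      have h3 : 2 * (p i : ℤ) ≤ m + t := by exact_mod_cast this
      omega)
  obtain ⟨T, hT, hTs⟩ := stable_int G hG q (((m : ℤ) - t) / 2).toNat
    (fun C hC => by
      have := hqC C hC
      simp only [hq] at this
      have h3 : 2 * ((∑ i ∈ C, q i : ℕ) : ℤ) ≤ m - t := by exact_mod_cast this
      omega)
  have hD1 : Dec (omegaPolytope (orderPolytope P) (stableSetPolytope G))
      (((m : ℤ) + t) / 2).toNat
      (Fin.snoc (fun i => (p i : ℝ)) ((((m : ℤ) + t) / 2).toNat : ℝ)) := by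
    refine ⟨fun j => Fin.snoc (indicator (S j)) (1 : ℝ), ?_, ?_⟩
    · intro j
      refine ⟨subset_convexHull ℝ _ (Or.inl ⟨_, subset_convexHull ℝ _ ⟨S j, hS j, rfl⟩, rfl⟩), ?_⟩
      intro i
      refine Fin.lastCases ?_ ?_ i
      · exact ⟨1, by simp⟩
      · intro i
        obtain ⟨u, hu⟩ := ind_lattice (S j) i
        exact ⟨u, by simp [hu]⟩
    · ext i
      rw [Finset.sum_apply]
      refine Fin.lastCases ?_ ?_ i
      · simp
      · intro i
        simp [hSs]
  have hD2 : Dec (omegaPolytope (orderPolytope P) (stableSetPolytope G))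
      (((m : ℤ) - t) / 2).toNat
      (Fin.snoc (fun i => -(q i : ℝ)) (-((((m : ℤ) - t) / 2).toNat : ℝ))) := by
    refine ⟨fun j => Fin.snoc (-indicator (T j)) (-1 : ℝ), ?_, ?_⟩
    · intro j
      refine ⟨subset_convexHull ℝ _ (Or.inr ⟨_, ?_, rfl⟩), ?_⟩
      · rw [Set.mem_neg, neg_neg]
        exact subset_convexHull ℝ _ ⟨T j, hT j, rfl⟩
      intro i
      refine Fin.lastCases ?_ ?_ i
      · exact ⟨-1, by simp⟩
      · intro i
        obtain ⟨u, hu⟩ := ind_lattice (T j) i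
        exact ⟨-u, by simp [hu]⟩
    · ext i
      rw [Finset.sum_apply]
      refine Fin.lastCases ?_ ?_ i
      · simp
      · intro i
        simp [hTs]
  have hD3 : ∀ r : ℕ, Dec (omegaPolytope (orderPolytope P) (stableSetPolytope G)) r 0 := by
    intro r
    refine ⟨fun _ => 0, fun _ => ⟨zero_mem_omega P G hG, fun i => ⟨0, by simp⟩⟩, by simp⟩
  have hD := (hD1.add hD2).add (hD3 (m - (((m : ℤ) + t) / 2).toNat - (((m : ℤ) - t) / 2).toNat))
  have hcount : (((m : ℤ) + t) / 2).toNat + (((m : ℤ) - t) / 2).toNat +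
      (m - (((m : ℤ) + t) / 2).toNat - (((m : ℤ) - t) / 2).toNat) = m := by
    omega
  rw [hcount] at hD
  have hdiff : t = ((((m : ℤ) + t) / 2).toNat : ℤ) - ((((m : ℤ) - t) / 2).toNat : ℤ) := by
    omega
  convert hD using 1
  rw [ha]
  ext i
  refine Fin.lastCases ?_ ?_ i
  · simp only [Fin.snoc_last, Pi.add_apply, Pi.zero_apply]
    have : (t : ℝ) = ((((((m : ℤ) + t) / 2).toNat : ℤ) - ((((m : ℤ) - t) / 2).toNat : ℤ) : ℤ) : ℝ) := by
      rw [← hdiff]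
    rw [this]
    push_cast
    ring
  · intro i
    simp only [Fin.snoc_castSucc, Pi.add_apply, Pi.zero_apply]
    have := hq i
    rw [hp] at this
    linarith

lemma omega_reflexive {d : ℕ} (P : PartialOrder (Fin d)) (G : SimpleGraph (Fin d))
    (hG : IsPerfectGraph G) :
    IsReflexive (omegaPolytope (orderPolytope P) (stableSetPolytope G)) := by
  have hfin := normals_finite P G
  refine ⟨?_, ?_⟩
  · have hopen : IsOpen (⋂ v ∈ normals P G, {z : Fin (d + 1) → ℝ | ∑ i, v i * z i < 1}) := by
      refine hfin.isOpen_biInter ?_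
      intro v _
      exact isOpen_lt (by fun_prop) continuous_const
    refine mem_interior.2 ⟨_, ?_, hopen, ?_⟩
    · intro z hz
      refine omega_of_normals P G hG z ?_
      intro v hv
      exact le_of_lt (Set.mem_iInter₂.1 hz v hv)
    · refine Set.mem_iInter₂.2 ?_
      intro v _
      simp
  · classical
    have hfin2 : (insert 0 (normals P G)).Finite := hfin.insert 0
    refine ⟨hfin2.toFinset, ?_, ?_⟩
    · intro v hv
      rw [Set.Finite.mem_toFinset] at hv
      rcases hv with rfl | hv
      · exact fun i => ⟨0, by simp⟩
      · exact normals_lattice P G v hv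
    · rw [Set.Finite.coe_toFinset]
      apply Set.Subset.antisymm
      · intro x hx
        by_contra hnot
        obtain ⟨f, u, hfu, hux⟩ := geometric_hahn_banach_closed_point
          (convex_convexHull ℝ (insert 0 (normals P G))) (hfin2.isClosed_convexHull ℝ) hnot
        have hu : 0 < u := by
          have := hfu 0 (subset_convexHull ℝ _ (Set.mem_insert _ _))
          simpa using this
        set w : Fin (d + 1) → ℝ := fun i => f (fun j => if i = j then 1 else 0) with hw
        have hf : ∀ v, f v = ∑ i, v i * w i := by
          intro v
          have := LinearMap.pi_apply_eq_sum_univ (f : (Fin (d + 1) → ℝ) →ₗ[ℝ] ℝ) v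
          simpa using this
        have hsc : ∀ v : Fin (d + 1) → ℝ, ∑ i, v i * (u⁻¹ • w) i = u⁻¹ * f v := by
          intro v
          rw [hf, Finset.mul_sum]
          refine Finset.sum_congr rfl ?_
          intro i _
          simp only [Pi.smul_apply, smul_eq_mul]
          ring
        have hmem := omega_of_normals P G hG (u⁻¹ • w) (by
          intro v hv
          rw [hsc, inv_mul_le_iff₀ hu, mul_one]
          exact (hfu v (subset_convexHull ℝ _ (Set.mem_insert_of_mem _ hv))).le)
        have hle := hx _ hmem
        rw [hsc, inv_mul_le_iff₀ hu, mul_one] at hle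
        linarith
      · intro x hx z hz
        have h1 : x ∈ {v : Fin (d + 1) → ℝ | ∑ i, z i * v i ≤ 1} := by
          refine convexHull_min ?_ (convex_half z 1) hx
          rintro v (rfl | hv)
          · simp
          · have := normals_valid P G v hv z hz
            simpa only [Set.mem_ofPred_eq, mul_comm] using this
        simpa only [Set.mem_ofPred_eq, mul_comm] using h1


/-- For every poset `P` on `[d]` and every perfect graph `G` on `[d]` (`d ≥ 1`),
`Ω(O_P, Q_G) ⊆ ℝ^{d+1}` is a reflexive polytope with the integer decomposition property. -/
theorem omega_reflexive_and_idp (d : ℕ) (hd : 1 ≤ d) (P : PartialOrder (Fin d))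
    (G : SimpleGraph (Fin d)) (hG : IsPerfectGraph G) :
    IsReflexive (omegaPolytope (orderPolytope P) (stableSetPolytope G)) ∧
      HasIDP (omegaPolytope (orderPolytope P) (stableSetPolytope G)) :=
  ⟨omega_reflexive P G hG, omega_idp P G hG⟩

end HibiTsuchiya
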